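/- arXiv:2105.00770 — 7 statements merged into one kernel-verified Lean document; each statement's English description precedes it below -/
import Mathlib

section
/- Let P and Q be probability distributions on the same finite set Ω and let ε, δ ≥ 0. If P and Q are (ε,δ)-log-ratio-close, then for every integer ℓ ≥ 1 and every δ' ∈ (0,1), the ℓ-fold product distributions P^ℓ and Q^ℓ (ℓ independent samples) are (η, ℓδ + δ')-log-ratio-close, where η = ℓ·ε·(e^ε − 1) + ε·√(2ℓ·ln(1/δ')). -/
/-- `P` is a probability distribution on the finite set `Ω`. -/
def IsDist {Ω : Type*} [Fintype Ω] (P : Ω → ℝ) : Prop :=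
  (∀ x, 0 ≤ P x) ∧ ∑ x, P x = 1

/-- `P` and `Q` are `(ε,δ)`-log-ratio-close: for every subset `A` of the domain,
`P(A) ≤ e^ε · Q(A) + δ` and `Q(A) ≤ e^ε · P(A) + δ`. -/
def LRClose {Ω : Type*} [Fintype Ω] (ε δ : ℝ) (P Q : Ω → ℝ) : Prop :=
  ∀ A : Finset Ω,
    (∑ x ∈ A, P x ≤ Real.exp ε * ∑ x ∈ A, Q x + δ) ∧
    (∑ x ∈ A, Q x ≤ Real.exp ε * ∑ x ∈ A, P x + δ)

open Finset in
/-- Two `(ε,δ)`-log-ratio-close distributions dominate sub-distributions of mass at least `1 - δ`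
whose pointwise ratio is at most `e^ε` in both directions. -/
theorem LRClose.exists_pure_minorants {Ω : Type*} [Fintype Ω] {P Q : Ω → ℝ} {ε δ : ℝ}
    (hε : 0 ≤ ε) (hP : IsDist P) (hQ : IsDist Q) (h : LRClose ε δ P Q) :
    ∃ P₁ Q₁ : Ω → ℝ, (∀ x, 0 ≤ P₁ x) ∧ (∀ x, 0 ≤ Q₁ x) ∧ (∀ x, P₁ x ≤ P x) ∧ (∀ x, Q₁ x ≤ Q x) ∧
      (∀ x, P₁ x ≤ Real.exp ε * Q₁ x) ∧ (∀ x, Q₁ x ≤ Real.exp ε * P₁ x) ∧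
      ∑ x, P₁ x ≤ ∑ x, Q₁ x ∧ 1 - δ ≤ ∑ x, P₁ x := by
  classical
  have he : 1 ≤ Real.exp ε := Real.one_le_exp hε
  have mass : ∀ R S : Ω → ℝ, ∑ x, R x = 1 →
      (∀ A : Finset Ω, ∑ x ∈ A, R x ≤ Real.exp ε * ∑ x ∈ A, S x + δ) →
      1 - δ ≤ ∑ x, min (R x) (Real.exp ε * S x) := by
    intro R S hR hRS
    have h1 := hRS {x | Real.exp ε * S x < R x}
    have h2 : ∑ x, min (R x) (Real.exp ε * S x) =
        ∑ x, R x - ∑ x with Real.exp ε * S x < R x, (R x - Real.exp ε * S x) := by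
      rw [sum_filter, ← sum_sub_distrib]
      refine sum_congr rfl fun x _ => ?_
      split_ifs with hx
      · rw [min_eq_right hx.le]; ring
      · rw [min_eq_left (not_lt.mp hx)]; ring
    rw [h2, sum_sub_distrib, ← mul_sum, hR]
    linarith
  have hmP := mass P Q hP.2 fun A => (h A).1
  have hmQ := mass Q P hQ.2 fun A => (h A).2
  set p : Ω → ℝ := fun x => min (P x) (Real.exp ε * Q x) with hp
  set q : Ω → ℝ := fun x => min (Q x) (Real.exp ε * P x) with hq
  have hp0 : ∀ x, 0 ≤ p x := fun x =>
    le_min (hP.1 x) (mul_nonneg (Real.exp_pos ε).le (hQ.1 x))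
  have hq0 : ∀ x, 0 ≤ q x := fun x =>
    le_min (hQ.1 x) (mul_nonneg (Real.exp_pos ε).le (hP.1 x))
  have hpP : ∀ x, p x ≤ P x := fun x => min_le_left _ _
  have hqQ : ∀ x, q x ≤ Q x := fun x => min_le_left _ _
  have ratio : ∀ a b : ℝ, 0 ≤ a → min a (Real.exp ε * b) ≤ Real.exp ε * min b (Real.exp ε * a) := by
    intro a b ha
    rw [mul_min_of_nonneg _ _ (Real.exp_pos ε).le]
    refine le_min (min_le_right _ _) ((min_le_left _ _).trans ?_)
    nlinarith [mul_nonneg (sub_nonneg.2 he) ha, mul_nonneg (sub_nonneg.2 he)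
      (mul_nonneg (Real.exp_pos ε).le ha)]
  have hpq : ∀ x, p x ≤ Real.exp ε * q x := fun x => ratio _ _ (hP.1 x)
  have hqp : ∀ x, q x ≤ Real.exp ε * p x := fun x => ratio _ _ (hQ.1 x)
  by_cases hle : ∑ x, p x ≤ ∑ x, q x
  · exact ⟨p, q, hp0, hq0, hpP, hqQ, hpq, hqp, hle, hmP⟩
  · -- lower `p` towards `min p q` until both masses agree
    push Not at hle
    have hmin : ∑ x, min (p x) (q x) ≤ ∑ x, q x := sum_le_sum fun x _ => min_le_right _ _
    set a := ∑ x, p x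
    set b := ∑ x, q x
    set c := ∑ x, min (p x) (q x) with hc
    have hac : 0 < a - c := by linarith
    set t := (b - c) / (a - c) with ht
    have ht0 : 0 ≤ t := div_nonneg (by linarith) hac.le
    have ht1 : t ≤ 1 := (div_le_one hac).2 (by linarith)
    have hr : ∀ x, min (p x) (q x) + t * (p x - min (p x) (q x)) ≤ p x := fun x => by
      nlinarith [mul_nonneg (sub_nonneg.2 ht1) (sub_nonneg.2 (min_le_left (p x) (q x)))]
    have hr' : ∀ x, min (p x) (q x) ≤ min (p x) (q x) + t * (p x - min (p x) (q x)) := fun x => by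
      nlinarith [mul_nonneg ht0 (sub_nonneg.2 (min_le_left (p x) (q x)))]
    have hsum : ∑ x, (min (p x) (q x) + t * (p x - min (p x) (q x))) = b := by
      rw [sum_add_distrib, ← mul_sum, sum_sub_distrib, ← hc]
      change c + t * (a - c) = b
      rw [ht, div_mul_cancel₀ _ hac.ne']
      ring
    refine ⟨fun x => min (p x) (q x) + t * (p x - min (p x) (q x)), q,
      fun x => (le_min (hp0 x) (hq0 x)).trans (hr' x), hq0, fun x => (hr x).trans (hpP x), hqQ,
      fun x => (hr x).trans (hpq x), fun x => ?_, hsum.le, hmQ.trans hsum.ge⟩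
    refine le_trans ?_ (mul_le_mul_of_nonneg_left (hr' x) (Real.exp_pos ε).le)
    rw [mul_min_of_nonneg _ _ (Real.exp_pos ε).le]
    exact le_min (hqp x) (le_mul_of_one_le_left (hq0 x) he)

/-- `sinh u ≤ u cosh u` for nonnegative `u`. -/
theorem Real.sinh_le_self_mul_cosh {u : ℝ} (hu : 0 ≤ u) : Real.sinh u ≤ u * Real.cosh u := by
  have hd : ∀ x : ℝ, HasDerivAt (fun x => x * Real.cosh x - Real.sinh x) (x * Real.sinh x) x :=
    fun x => (((hasDerivAt_id' x).mul (Real.hasDerivAt_cosh x)).sub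
      (Real.hasDerivAt_sinh x)).congr_deriv (by ring)
  have hmono : MonotoneOn (fun x => x * Real.cosh x - Real.sinh x) (Set.Ici 0) := by
    refine monotoneOn_of_deriv_nonneg (convex_Ici 0)
      (fun x _ => (hd x).continuousAt.continuousWithinAt)
      (fun x _ => (hd x).differentiableAt.differentiableWithinAt) fun x hx => ?_
    have hx0 : 0 ≤ x := interior_subset hx
    rw [(hd x).deriv]
    exact mul_nonneg hx0 (Real.sinh_nonneg_iff.2 hx0)
  simpa using hmono Set.self_mem_Ici hu hu

open Finset in
/-- The first moment bound for a bounded log-ratio. -/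
theorem sum_mul_logRatio_le {Ω : Type*} [Fintype Ω] {p q L : Ω → ℝ} {ε : ℝ}
    (hε : 0 ≤ ε) (hp : ∀ x, 0 ≤ p x) (hq : ∀ x, 0 ≤ q x)
    (hpq : ∀ x, p x ≤ Real.exp ε * q x) (hqp : ∀ x, q x ≤ Real.exp ε * p x)
    (hm : ∑ x, p x ≤ ∑ x, q x) (hL : ∀ x, p x = Real.exp (L x) * q x) (hLε : ∀ x, |L x| ≤ ε) :
    ∑ x, p x * L x ≤ ε * (Real.exp ε - 1) * ∑ x, p x := by
  have he : 0 ≤ Real.exp ε - 1 := sub_nonneg.2 (Real.one_le_exp hε)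
  have key : ∀ x, p x * L x ≤ ε * (Real.exp ε - 1) * p x + (p x - q x) := by
    intro x
    have h1 : q x * L x ≤ p x - q x := by
      have := mul_le_mul_of_nonneg_left (Real.add_one_le_exp (L x)) (hq x)
      rw [hL x]; linarith
    have h2 : |p x - q x| ≤ (Real.exp ε - 1) * p x := by
      rw [abs_le]
      constructor
      · linarith [hqp x]
      · rcases le_total (p x) (q x) with h | h
        · nlinarith [mul_nonneg he (hp x)]
        · nlinarith [hpq x, mul_le_mul_of_nonneg_left h he]
    have h3 : (p x - q x) * L x ≤ (Real.exp ε - 1) * p x * ε :=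
      (le_abs_self _).trans (by
        rw [abs_mul]
        exact mul_le_mul h2 (hLε x) (abs_nonneg _) (mul_nonneg he (hp x)))
    linarith
  calc ∑ x, p x * L x ≤ ∑ x, (ε * (Real.exp ε - 1) * p x + (p x - q x)) :=
        sum_le_sum fun x _ => key x
    _ ≤ _ := by
        rw [sum_add_distrib, sum_sub_distrib, ← mul_sum]
        linarith

open Finset in
/-- A Hoeffding-type bound for the exponential moment of a bounded log-ratio. -/
theorem sum_mul_exp_logRatio_le {Ω : Type*} [Fintype Ω] {p L : Ω → ℝ} {ε c u : ℝ}
    (hε : 0 < ε) (hc : 0 ≤ c) (hu : 0 ≤ u) (hp : ∀ x, 0 ≤ p x) (hp1 : ∑ x, p x ≤ 1)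
    (hmean : ∑ x, p x * L x ≤ ε * c * ∑ x, p x) (hLε : ∀ x, |L x| ≤ ε) :
    ∑ x, p x * Real.exp (L x / ε * u) ≤ Real.exp (c * u + u ^ 2 / 2) := by
  have hs : 0 ≤ Real.sinh u := Real.sinh_nonneg_iff.2 hu
  have hmean' : (∑ x, p x * L x) / ε ≤ c * ∑ x, p x := by
    rw [div_le_iff₀ hε]; linarith
  have hB : 0 ≤ Real.cosh u + c * Real.sinh u :=
    add_nonneg (Real.cosh_pos u).le (mul_nonneg hc hs)
  calc ∑ x, p x * Real.exp (L x / ε * u)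
      ≤ ∑ x, p x * (Real.cosh u + L x / ε * Real.sinh u) :=
        sum_le_sum fun x _ => mul_le_mul_of_nonneg_left (Real.exp_mul_le_cosh_add_mul_sinh
          (by rw [abs_div, abs_of_pos hε]; exact (div_le_one hε).2 (hLε x)) u) (hp x)
    _ = (∑ x, p x) * Real.cosh u + (∑ x, p x * L x) / ε * Real.sinh u := by
        rw [sum_mul, sum_div, sum_mul, ← sum_add_distrib]
        exact sum_congr rfl fun x _ => by ring
    _ ≤ (∑ x, p x) * Real.cosh u + c * (∑ x, p x) * Real.sinh u := by gcongr
    _ = (∑ x, p x) * (Real.cosh u + c * Real.sinh u) := by ring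
    _ ≤ 1 * (Real.cosh u + c * Real.sinh u) := by gcongr
    _ ≤ (1 + c * u) * Real.cosh u := by
        linarith [mul_le_mul_of_nonneg_left (Real.sinh_le_self_mul_cosh hu) hc]
    _ ≤ Real.exp (c * u) * Real.exp (u ^ 2 / 2) := by
        gcongr
        · linarith [Real.add_one_le_exp (c * u)]
        · exact Real.cosh_le_exp_half_sq u
    _ = _ := (Real.exp_add _ _).symm

open Finset in
/-- Advanced composition for a pair of sub-distributions with bounded ratio. -/
theorem sum_prod_le_of_ratio_le {Ω : Type*} [Fintype Ω] {p q : Ω → ℝ} {ε : ℝ}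
    (hε : 0 ≤ ε) (hp : ∀ x, 0 ≤ p x) (hq : ∀ x, 0 ≤ q x)
    (hpq : ∀ x, p x ≤ Real.exp ε * q x) (hqp : ∀ x, q x ≤ Real.exp ε * p x)
    (hp1 : ∑ x, p x ≤ 1) (hm : ∑ x, p x ≤ ∑ x, q x) {ℓ : ℕ} (hℓ : 1 ≤ ℓ) {δ' : ℝ}
    (hδ' : δ' ∈ Set.Ioo (0 : ℝ) 1) (A : Finset (Fin ℓ → Ω)) :
    ∑ x ∈ A, ∏ i, p (x i) ≤
      Real.exp ((ℓ : ℝ) * ε * (Real.exp ε - 1) + ε * Real.sqrt (2 * ℓ * Real.log (1 / δ'))) *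
        ∑ x ∈ A, ∏ i, q (x i) + δ' := by
  classical
  rcases hε.eq_or_lt with rfl | hε'
  · have : p = q := funext fun x => le_antisymm (by simpa using hpq x) (by simpa using hqp x)
    simp [this, hδ'.1.le]
  have he : 0 ≤ Real.exp ε - 1 := sub_nonneg.2 (Real.one_le_exp hε)
  set L : Ω → ℝ := fun x => Real.log (p x / q x) with hLdef
  have hzero : ∀ x, p x = 0 → q x = 0 := fun x h =>
    le_antisymm (by simpa [h] using hqp x) (hq x)
  have hpos : ∀ x, p x ≠ 0 → 0 < p x ∧ 0 < q x := fun x h => by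
    have h1 := (hp x).lt_of_ne' h
    exact ⟨h1, pos_of_mul_pos_right (h1.trans_le (hpq x)) (Real.exp_pos ε).le⟩
  have hL : ∀ x, p x = Real.exp (L x) * q x := fun x => by
    by_cases h : p x = 0
    · rw [h, hzero x h, mul_zero]
    · obtain ⟨h1, h2⟩ := hpos x h
      rw [hLdef, Real.exp_log (div_pos h1 h2), div_mul_cancel₀ _ h2.ne']
  have hLε : ∀ x, |L x| ≤ ε := fun x => by
    by_cases h : p x = 0
    · simp [hLdef, h, hε]
    · obtain ⟨h1, h2⟩ := hpos x h
      rw [abs_le]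
      constructor
      · rw [hLdef, Real.le_log_iff_exp_le (div_pos h1 h2), le_div_iff₀ h2, Real.exp_neg,
          inv_mul_le_iff₀ (Real.exp_pos ε)]
        exact hqp x
      · rw [hLdef, Real.log_le_iff_le_exp (div_pos h1 h2), div_le_iff₀ h2]
        exact hpq x
  have hmean := sum_mul_logRatio_le hε hp hq hpq hqp hm hL hLε
  have hlog : 0 ≤ Real.log (1 / δ') :=
    Real.log_nonneg (by rw [le_div_iff₀ hδ'.1]; linarith [hδ'.2])
  have hℓ0 : (0 : ℝ) < ℓ := by exact_mod_cast hℓ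
  set T := Real.sqrt (2 * ℓ * Real.log (1 / δ')) with hT
  have hT2 : T ^ 2 = 2 * ℓ * Real.log (1 / δ') := Real.sq_sqrt (by positivity)
  have hT0 : 0 ≤ T := Real.sqrt_nonneg _
  set c := Real.exp ε - 1 with hc
  set η := (ℓ : ℝ) * ε * c + ε * T with hη
  set u := T / ℓ with hu
  have hu0 : 0 ≤ u := div_nonneg hT0 hℓ0.le
  have hmgf := sum_mul_exp_logRatio_le hε' he hu0 hp hp1 hmean hLε
  have hpp : ∀ x : Fin ℓ → Ω, 0 ≤ ∏ i, p (x i) := fun x => prod_nonneg fun i _ => hp _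
  have hqq : ∀ x : Fin ℓ → Ω, 0 ≤ ∏ i, q (x i) := fun x => prod_nonneg fun i _ => hq _
  have point : ∀ x : Fin ℓ → Ω, ∏ i, p (x i) ≤ Real.exp η * ∏ i, q (x i) +
      (∏ i, p (x i) * Real.exp (L (x i) / ε * u)) * Real.exp (-(η / ε * u)) := by
    intro x
    rw [prod_mul_distrib, ← Real.exp_sum, mul_assoc, ← Real.exp_add, ← sum_mul, ← sum_div]
    rcases le_total (∑ i, L (x i)) η with h | h
    · have h1 : ∏ i, p (x i) ≤ Real.exp η * ∏ i, q (x i) := by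
        rw [prod_congr rfl fun i _ => hL (x i), prod_mul_distrib, ← Real.exp_sum]
        exact mul_le_mul_of_nonneg_right (Real.exp_le_exp.2 h) (hqq x)
      exact h1.trans (le_add_of_nonneg_right (mul_nonneg (hpp x) (Real.exp_pos _).le))
    · refine le_add_of_nonneg_of_le (mul_nonneg (Real.exp_pos _).le (hqq x))
        (le_mul_of_one_le_right (hpp x) (Real.one_le_exp ?_))
      have : η / ε * u ≤ (∑ i, L (x i)) / ε * u := by gcongr
      linarith
  have tail : ∑ x : Fin ℓ → Ω,
      (∏ i, p (x i) * Real.exp (L (x i) / ε * u)) * Real.exp (-(η / ε * u)) ≤ δ' := by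
    rw [← sum_mul, ← Fintype.sum_pow (fun x => p x * Real.exp (L x / ε * u)) ℓ]
    calc _ ≤ Real.exp (c * u + u ^ 2 / 2) ^ ℓ * Real.exp (-(η / ε * u)) := by
          gcongr
          exact sum_nonneg fun x _ => mul_nonneg (hp x) (Real.exp_pos _).le
      _ = Real.exp (-Real.log (1 / δ')) := by
          rw [← Real.exp_nat_mul, ← Real.exp_add]
          congr 1
          have h1 : η / ε = ℓ * c + T := by rw [hη]; field_simp
          have h2 : Real.log (1 / δ') = T ^ 2 / (2 * ℓ) := by rw [hT2]; field_simp
          rw [h1, h2, hu]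
          field_simp
          ring
      _ = δ' := by rw [one_div, Real.log_inv, neg_neg, Real.exp_log hδ'.1]
  calc ∑ x ∈ A, ∏ i, p (x i)
      ≤ ∑ x ∈ A, (Real.exp η * ∏ i, q (x i) +
          (∏ i, p (x i) * Real.exp (L (x i) / ε * u)) * Real.exp (-(η / ε * u))) :=
        sum_le_sum fun x _ => point x
    _ ≤ _ := by
        rw [sum_add_distrib, ← mul_sum]
        gcongr
        refine le_trans (sum_le_sum_of_subset_of_nonneg (subset_univ A) fun x _ _ => ?_) tail
        exact mul_nonneg (prod_nonneg fun i _ => mul_nonneg (hp _) (Real.exp_pos _).le)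
          (Real.exp_pos _).le

/-- Log-ratio closeness is symmetric. -/
theorem LRClose.symm {Ω : Type*} [Fintype Ω] {P Q : Ω → ℝ} {ε δ : ℝ} (h : LRClose ε δ P Q) :
    LRClose ε δ Q P :=
  fun A => (h A).symm

open Finset in
/-- One direction of the composition theorem. -/
theorem LRClose.sum_prod_le {Ω : Type*} [Fintype Ω] {P Q : Ω → ℝ} {ε δ : ℝ}
    (hε : 0 ≤ ε) (hP : IsDist P) (hQ : IsDist Q) (h : LRClose ε δ P Q) {ℓ : ℕ} (hℓ : 1 ≤ ℓ)
    {δ' : ℝ} (hδ' : δ' ∈ Set.Ioo (0 : ℝ) 1) (A : Finset (Fin ℓ → Ω)) :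
    ∑ x ∈ A, ∏ i, P (x i) ≤
      Real.exp ((ℓ : ℝ) * ε * (Real.exp ε - 1) + ε * Real.sqrt (2 * ℓ * Real.log (1 / δ'))) *
        ∑ x ∈ A, ∏ i, Q (x i) + ((ℓ : ℝ) * δ + δ') := by
  classical
  obtain ⟨p, q, hp, hq, hpP, hqQ, hpq, hqp, hm, hmass⟩ := h.exists_pure_minorants hε hP hQ
  have hp1 : ∑ x, p x ≤ 1 := hP.2 ▸ sum_le_sum fun x _ => hpP x
  have hp0 : 0 ≤ ∑ x, p x := sum_nonneg fun x _ => hp x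
  have hpure := sum_prod_le_of_ratio_le hε hp hq hpq hqp hp1 hm hℓ hδ' A
  have hqprod : ∑ x ∈ A, ∏ i, q (x i) ≤ ∑ x ∈ A, ∏ i, Q (x i) :=
    sum_le_sum fun x _ => prod_le_prod (fun i _ => hq _) fun i _ => hqQ _
  have hdiff : ∑ x ∈ A, (∏ i, P (x i) - ∏ i, p (x i)) ≤ ℓ * δ := by
    calc ∑ x ∈ A, (∏ i, P (x i) - ∏ i, p (x i))
        ≤ ∑ x : Fin ℓ → Ω, (∏ i, P (x i) - ∏ i, p (x i)) :=
          sum_le_sum_of_subset_of_nonneg (subset_univ A) fun x _ _ =>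
            sub_nonneg.2 (prod_le_prod (fun i _ => hp _) fun i _ => hpP _)
      _ = 1 - (∑ x, p x) ^ ℓ := by
          rw [sum_sub_distrib, ← Fintype.sum_pow, ← Fintype.sum_pow, hP.2, one_pow]
      _ ≤ ℓ * (1 - ∑ x, p x) := by
          have := one_add_mul_sub_le_pow (a := ∑ x, p x) (by linarith) ℓ
          linarith
      _ ≤ ℓ * δ := by gcongr; linarith
  rw [sum_sub_distrib] at hdiff
  have := mul_le_mul_of_nonneg_left hqprod (Real.exp_pos
    ((ℓ : ℝ) * ε * (Real.exp ε - 1) + ε * Real.sqrt (2 * ℓ * Real.log (1 / δ')))).le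
  linarith

/-- Log-ratio distance under `ℓ`-fold independent repetition: if `P ≈_{ε,δ} Q` then
`P^ℓ ≈_{η, ℓδ+δ'} Q^ℓ` where `η = ℓ·ε·(e^ε − 1) + ε·√(2ℓ·ln(1/δ'))`. -/
theorem lrClose_prod {Ω : Type*} [Fintype Ω] (P Q : Ω → ℝ) (ε δ : ℝ)
    (hε : 0 ≤ ε) (hδ : 0 ≤ δ) (hP : IsDist P) (hQ : IsDist Q)
    (h : LRClose ε δ P Q) (ℓ : ℕ) (hℓ : 1 ≤ ℓ) (δ' : ℝ) (hδ' : δ' ∈ Set.Ioo (0:ℝ) 1) :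
    LRClose ((ℓ : ℝ) * ε * (Real.exp ε - 1) + ε * Real.sqrt (2 * ℓ * Real.log (1 / δ')))
      ((ℓ : ℝ) * δ + δ')
      (fun x : Fin ℓ → Ω => ∏ i, P (x i))
      (fun x : Fin ℓ → Ω => ∏ i, Q (x i)) := by
  exact fun A => ⟨h.sum_prod_le hε hP hQ hℓ hδ' A, h.symm.sum_prod_le hε hQ hP hℓ hδ' A⟩
end

section
/- Let P and Q be probability distributions on the same finite set Ω and ε ≥ 0. If P and Q are (ε,0)-log-ratio-close, then the Kullback–Leibler divergence of P from Q is at most ε·(e^ε − 1); that is, ∑_{x∈Ω} P(x)·log(P(x)/Q(x)) ≤ ε·(e^ε − 1) (with the convention that terms with P(x) = 0 contribute 0; note (ε,0)-closeness forces P and Q to have equal support). -/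
theorem mul_log_div_le {p q ε : ℝ} (hε : 0 ≤ ε) (hp : 0 ≤ p) (hq : 0 ≤ q)
    (hpq : p ≤ Real.exp ε * q) (hqp : q ≤ Real.exp ε * p) :
    p * Real.log (p / q) ≤ ε * (Real.exp ε - 1) * q + (p - q) := by
  have hexp : 0 ≤ Real.exp ε - 1 := sub_nonneg.2 (Real.one_le_exp hε)
  rcases hq.eq_or_lt with rfl | hq
  · simpa using hp
  have hp : 0 < p := pos_of_mul_pos_right (hq.trans_le hqp) (Real.exp_pos ε).le
  have hle : Real.log (p / q) ≤ ε := by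
    rw [Real.log_le_iff_le_exp (div_pos hp hq), div_le_iff₀ hq]
    exact hpq
  have hge : -ε ≤ Real.log (p / q) := by
    rw [← inv_div, Real.log_inv, neg_le_neg_iff, Real.log_le_iff_le_exp (div_pos hq hp),
      div_le_iff₀ hp]
    exact hqp
  have hlog : q * Real.log (p / q) ≤ p - q := by
    calc q * Real.log (p / q) ≤ q * (p / q - 1) :=
          mul_le_mul_of_nonneg_left (Real.log_le_sub_one_of_pos (div_pos hp hq)) hq.le
      _ = p - q := by field_simp
  have hdiff : |p - q| ≤ (Real.exp ε - 1) * q := by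
    rw [abs_le]
    rcases le_total p q with hle | hle
    · have := mul_le_mul_of_nonneg_left hle hexp
      constructor <;> linarith
    · have := mul_nonneg hexp hq.le
      constructor <;> linarith
  have hprod : (p - q) * Real.log (p / q) ≤ (Real.exp ε - 1) * q * ε :=
    calc (p - q) * Real.log (p / q) ≤ |p - q| * |Real.log (p / q)| :=
          (le_abs_self _).trans (abs_mul _ _).le
      _ ≤ (Real.exp ε - 1) * q * ε :=
          mul_le_mul hdiff (abs_le.2 ⟨hge, hle⟩) (abs_nonneg _) (mul_nonneg hexp hq.le)
  linarith

/-- If `P ≈_{ε,0} Q`, then `KL(P‖Q) = ∑ P(x)·log(P(x)/Q(x)) ≤ ε·(e^ε − 1)`.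
(When `P x = 0` the summand is `0·log(0/Q x) = 0`, matching the convention.) -/
theorem kl_le_of_lrClose {Ω : Type*} [Fintype Ω] (P Q : Ω → ℝ) (ε : ℝ) (hε : 0 ≤ ε)
    (hP : IsDist P) (hQ : IsDist Q) (h : LRClose ε 0 P Q) :
    ∑ x, P x * Real.log (P x / Q x) ≤ ε * (Real.exp ε - 1) := by
  calc ∑ x, P x * Real.log (P x / Q x)
      ≤ ∑ x, (ε * (Real.exp ε - 1) * Q x + (P x - Q x)) :=
        Finset.sum_le_sum fun x _ => mul_log_div_le hε (hP.1 x) (hQ.1 x)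
          (by simpa using (h {x}).1) (by simpa using (h {x}).2)
    _ = ε * (Real.exp ε - 1) := by
        rw [Finset.sum_add_distrib, Finset.sum_sub_distrib, ← Finset.mul_sum, hP.2, hQ.2]
        ring
end

section
/- Let P and Q be probability distributions on the same finite set Ω and ε, δ ≥ 0. If P and Q are (ε,δ)-log-ratio-close, then there exists a probability distribution P' on Ω such that P' and Q are (ε,0)-log-ratio-close and the statistical distance between P' and P is at most δ. -/
/-- The statistical distance between `P` and `Q`: the maximum over subsets `A` of
`|P(A) − Q(A)|`. -/
noncomputable def SD {Ω : Type*} [Fintype Ω] (P Q : Ω → ℝ) : ℝ :=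
  (Finset.univ : Finset Ω).powerset.sup' (Finset.powerset_nonempty _)
    (fun A => |∑ x ∈ A, P x - ∑ x ∈ A, Q x|)

/-- Between two functions whose sums enclose `c` there is a function with sum `c`. -/
lemma exists_between_sum_eq {Ω : Type*} [Fintype Ω] {F G : Ω → ℝ} {c : ℝ}
    (hFG : ∀ x, F x ≤ G x) (hF : ∑ x, F x ≤ c) (hG : c ≤ ∑ x, G x) :
    ∃ R : Ω → ℝ, (∀ x, F x ≤ R x ∧ R x ≤ G x) ∧ ∑ x, R x = c := by
  have hcont : ContinuousOn (fun t : ℝ => ∑ x, (F x + t * (G x - F x))) (Set.Icc 0 1) := by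
    fun_prop
  obtain ⟨t, ⟨h0, h1⟩, ht⟩ := intermediate_value_Icc zero_le_one hcont
    (show c ∈ Set.Icc _ _ by simpa using ⟨hF, hG⟩)
  exact ⟨_, fun x => ⟨by nlinarith [hFG x], by nlinarith [hFG x]⟩, ht⟩

/-- A bound on the sums of `f` over all finsets bounds the sums of its positive part. -/
lemma sum_max_zero_le {Ω : Type*} {f : Ω → ℝ} {δ : ℝ}
    (hf : ∀ A : Finset Ω, ∑ x ∈ A, f x ≤ δ) (A : Finset Ω) : ∑ x ∈ A, max (f x) 0 ≤ δ := by
  classical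
  refine le_trans (le_of_eq ?_) (hf (A.filter fun x => 0 < f x))
  rw [Finset.sum_filter]
  refine Finset.sum_congr rfl fun x _ => ?_
  split_ifs with h
  · exact max_eq_left h.le
  · exact max_eq_right (not_lt.mp h)

lemma SD_comm {Ω : Type*} [Fintype Ω] (P Q : Ω → ℝ) : SD P Q = SD Q P := by
  simp only [SD, abs_sub_comm]

/-- For functions of equal total sum, a one-sided bound on all events bounds the statistical
distance. -/
lemma SD_le_of_forall_sub_le {Ω : Type*} [Fintype Ω] {P Q : Ω → ℝ} {δ : ℝ}
    (hPQ : ∑ x, P x = ∑ x, Q x) (h : ∀ A : Finset Ω, ∑ x ∈ A, P x - ∑ x ∈ A, Q x ≤ δ) :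
    SD P Q ≤ δ := by
  classical
  refine Finset.sup'_le _ _ fun A _ => abs_le.mpr ⟨?_, h A⟩
  linarith [h Aᶜ, Finset.sum_add_sum_compl A P, Finset.sum_add_sum_compl A Q]

/-- For functions of equal total sum, a pointwise bound `P - Q ≤ max f 0` and a bound on all sums
of `f` bound the statistical distance. -/
lemma SD_le_of_sub_le_max {Ω : Type*} [Fintype Ω] {P Q f : Ω → ℝ} {δ : ℝ}
    (hPQ : ∑ x, P x = ∑ x, Q x) (hf : ∀ A : Finset Ω, ∑ x ∈ A, f x ≤ δ)
    (h : ∀ x, P x - Q x ≤ max (f x) 0) : SD P Q ≤ δ :=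
  SD_le_of_forall_sub_le hPQ fun A => by
    rw [← Finset.sum_sub_distrib]
    exact (Finset.sum_le_sum fun x _ => h x).trans (sum_max_zero_le hf A)

lemma LRClose.of_pointwise {Ω : Type*} [Fintype Ω] {P Q : Ω → ℝ} {ε : ℝ}
    (hl : ∀ x, Real.exp (-ε) * Q x ≤ P x) (hu : ∀ x, P x ≤ Real.exp ε * Q x) :
    LRClose ε 0 P Q := by
  refine fun A => ⟨?_, ?_⟩ <;> rw [add_zero, Finset.mul_sum] <;>
    refine Finset.sum_le_sum fun x _ => ?_
  · exact hu x
  · have := mul_le_mul_of_nonneg_left (hl x) (Real.exp_pos ε).le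
    rwa [← mul_assoc, ← Real.exp_add, add_neg_cancel, Real.exp_zero, one_mul] at this

/-- If `P ≈_{ε,δ} Q`, there is a distribution `P'` with `P' ≈_{ε,0} Q` and `SD(P',P) ≤ δ`. -/
theorem exists_lrClose_eps_zero {Ω : Type*} [Fintype Ω] (P Q : Ω → ℝ) (ε δ : ℝ)
    (hε : 0 ≤ ε) (hδ : 0 ≤ δ) (hP : IsDist P) (hQ : IsDist Q) (h : LRClose ε δ P Q) :
    ∃ P' : Ω → ℝ, IsDist P' ∧ LRClose ε 0 P' Q ∧ SD P' P ≤ δ := by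
  have he : 1 ≤ Real.exp ε := Real.one_le_exp hε
  have he' : Real.exp (-ε) ≤ 1 := Real.exp_le_one_iff.mpr (neg_nonpos.mpr hε)
  have hmul : Real.exp (-ε) * Real.exp ε = 1 := by rw [← Real.exp_add]; simp
  set L : Ω → ℝ := fun x => Real.exp (-ε) * Q x
  set U : Ω → ℝ := fun x => Real.exp ε * Q x
  have hLU : ∀ x, L x ≤ U x := fun x =>
    mul_le_mul_of_nonneg_right (he'.trans he) (hQ.1 x)
  have hL0 : ∀ x, 0 ≤ L x := fun x => mul_nonneg (Real.exp_pos _).le (hQ.1 x)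
  have hLsum : ∑ x, L x ≤ 1 := by rw [← Finset.mul_sum, hQ.2, mul_one]; exact he'
  have hUsum : 1 ≤ ∑ x, U x := by rw [← Finset.mul_sum, hQ.2, mul_one]; exact he
  have hPU : ∀ A : Finset Ω, ∑ x ∈ A, (P x - U x) ≤ δ := fun A => by
    rw [Finset.sum_sub_distrib, ← Finset.mul_sum]
    linarith [(h A).1]
  have hLP : ∀ A : Finset Ω, ∑ x ∈ A, (L x - P x) ≤ δ := fun A => by
    rw [Finset.sum_sub_distrib, ← Finset.mul_sum]
    have h1 := mul_le_mul_of_nonneg_left (h A).2 (Real.exp_pos (-ε)).le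
    rw [mul_add, ← mul_assoc, hmul, one_mul] at h1
    linarith [mul_le_of_le_one_left hδ he']
  set C : Ω → ℝ := fun x => max (L x) (min (P x) (U x))
  have hLC : ∀ x, L x ≤ C x := fun x => le_max_left _ _
  have hCU : ∀ x, C x ≤ U x := fun x => max_le (hLU x) (min_le_right _ _)
  rcases le_total (∑ x, C x) 1 with hs | hs
  · obtain ⟨R, hR, hR1⟩ := exists_between_sum_eq hCU hs hUsum
    have hLR : ∀ x, L x ≤ R x := fun x => (hLC x).trans (hR x).1
    refine ⟨R, ⟨fun x => (hL0 x).trans (hLR x), hR1⟩, .of_pointwise hLR fun x => (hR x).2, ?_⟩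
    rw [SD_comm]
    refine SD_le_of_sub_le_max (hP.2.trans hR1.symm) hPU fun x => ?_
    have h1 : min (P x) (U x) ≤ R x := (le_max_right _ _).trans (hR x).1
    grind
  · obtain ⟨R, hR, hR1⟩ := exists_between_sum_eq hLC hLsum hs
    refine ⟨R, ⟨fun x => (hL0 x).trans (hR x).1, hR1⟩,
      .of_pointwise (fun x => (hR x).1) fun x => (hR x).2.trans (hCU x), ?_⟩
    refine SD_le_of_sub_le_max (hR1.trans hP.2.symm) hLP fun x => ?_
    have h1 : R x ≤ max (L x) (P x) := (hR x).2.trans (max_le_max le_rfl (min_le_left _ _))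
    grind
end

section
/- Let 0 < ε < μ < 1, and let (X,Y) and (X̃,Ỹ) be pairs of random variables, each pair jointly distributed over the same finite domain 𝒳 × 𝒴, such that the statistical distance between the joint distribution of (X,Y) and the joint distribution of (X̃,Ỹ) is at most ε. Let E₀, E₁ ⊆ 𝒳 × 𝒴 be sets such that Pr[(X,Y) ∈ E_b] ≥ μ for both b ∈ {0,1}. Then SD( X̃ conditioned on {(X̃,Ỹ) ∈ E₀}, X̃ conditioned on {(X̃,Ỹ) ∈ E₁} ) ≤ SD( X conditioned on {(X,Y) ∈ E₀}, X conditioned on {(X,Y) ∈ E₁} ) + 4ε/μ. -/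
/-- The distribution of the first coordinate `X` of a jointly distributed pair `(X,Y) ∼ P`,
conditioned on the event `{(X,Y) ∈ E}`. -/
noncomputable def condMargFst {X Y : Type*} [Fintype X] [Fintype Y] [DecidableEq X]
    (P : X × Y → ℝ) (E : Finset (X × Y)) : X → ℝ :=
  fun x => (∑ p ∈ E, if p.1 = x then P p else 0) / ∑ p ∈ E, P p

/-- Every event changes its weight by at most the statistical distance. -/
theorem abs_sum_sub_sum_le_SD {Ω : Type*} [Fintype Ω] (P Q : Ω → ℝ) (A : Finset Ω) :
    |∑ x ∈ A, P x - ∑ x ∈ A, Q x| ≤ SD P Q :=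
  Finset.le_sup' (fun A : Finset Ω => |∑ x ∈ A, P x - ∑ x ∈ A, Q x|)
    (Finset.mem_powerset.2 (Finset.subset_univ A))

/-- The conditional probability that the first coordinate lies in `A`, as a quotient. -/
theorem sum_condMargFst {X Y : Type*} [Fintype X] [Fintype Y] [DecidableEq X]
    (P : X × Y → ℝ) (E : Finset (X × Y)) (A : Finset X) :
    ∑ x ∈ A, condMargFst P E x = (∑ p ∈ E with p.1 ∈ A, P p) / ∑ p ∈ E, P p := by
  simp only [condMargFst]
  rw [← Finset.sum_div, Finset.sum_comm, Finset.sum_filter]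
  simp only [Finset.sum_ite_eq]

theorem abs_div_sub_div_le {a p b q ε μ : ℝ} (hμ : 0 < μ) (hp : μ ≤ p) (hq : 0 < q)
    (hb : 0 ≤ b) (hbq : b ≤ q) (hab : |a - b| ≤ ε) (hpq : |p - q| ≤ ε) :
    |b / q - a / p| ≤ 2 * ε / μ := by
  have hp0 : 0 < p := hμ.trans_le hp
  have hε : 0 ≤ ε := (abs_nonneg _).trans hab
  have key : b / q - a / p = (b / q * (p - q) - (a - b)) / p := by
    field_simp
    ring
  rw [key, abs_div, abs_of_pos hp0]
  have hr : |b / q * (p - q)| ≤ ε := by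
    rw [abs_mul, abs_of_nonneg (div_nonneg hb hq.le)]
    exact (mul_le_of_le_one_left (abs_nonneg _) ((div_le_one hq).2 hbq)).trans hpq
  have hnum : |b / q * (p - q) - (a - b)| ≤ 2 * ε := by
    linarith [abs_sub (b / q * (p - q)) (a - b)]
  gcongr

/-- Conditioning on an event of probability at least `μ` moves the probability of every event of
the first coordinate by at most `2ε/μ` between `ε`-close distributions. -/
theorem abs_sum_condMargFst_sub_le {X Y : Type*} [Fintype X] [Fintype Y] [DecidableEq X]
    {ε μ : ℝ} (hμ : 0 < μ) (hεμ : ε < μ) {P Q : X × Y → ℝ} (hQ : ∀ p, 0 ≤ Q p)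
    (hSD : SD P Q ≤ ε) {E : Finset (X × Y)} (hE : μ ≤ ∑ p ∈ E, P p) (A : Finset X) :
    |∑ x ∈ A, condMargFst Q E x - ∑ x ∈ A, condMargFst P E x| ≤ 2 * ε / μ := by
  have hE' := (abs_sum_sub_sum_le_SD P Q E).trans hSD
  have hQE : 0 < ∑ p ∈ E, Q p := by linarith [(abs_le.1 hE').2]
  rw [sum_condMargFst, sum_condMargFst]
  exact abs_div_sub_div_le hμ hE hQE (Finset.sum_nonneg fun p _ => hQ p)
    (Finset.sum_le_sum_of_subset_of_nonneg (Finset.filter_subset _ _) fun p _ _ => hQ p)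
    ((abs_sum_sub_sum_le_SD P Q _).trans hSD) hE'

/-- If the joint distributions of `(X,Y)` and `(X̃,Ỹ)` are `ε`-close in statistical distance,
and `Pr[(X,Y) ∈ E_b] ≥ μ` for `b ∈ {0,1}`, then
`SD(X̃|E₀, X̃|E₁) ≤ SD(X|E₀, X|E₁) + 4ε/μ`. -/
theorem sd_condMarg_close {X Y : Type*} [Fintype X] [Fintype Y] [DecidableEq X]
    (ε μ : ℝ) (hε : 0 < ε) (hεμ : ε < μ) (hμ : μ < 1)
    (P Pt : X × Y → ℝ) (hP : IsDist P) (hPt : IsDist Pt)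
    (hSD : SD P Pt ≤ ε)
    (E₀ E₁ : Finset (X × Y))
    (h₀ : μ ≤ ∑ p ∈ E₀, P p) (h₁ : μ ≤ ∑ p ∈ E₁, P p) :
    SD (condMargFst Pt E₀) (condMargFst Pt E₁)
      ≤ SD (condMargFst P E₀) (condMargFst P E₁) + 4 * ε / μ := by
  have hμ0 : 0 < μ := hε.trans hεμ
  refine Finset.sup'_le _ _ fun A _ => ?_
  have b₀ := abs_le.1 (abs_sum_condMargFst_sub_le hμ0 hεμ hPt.1 hSD h₀ A)
  have b₁ := abs_le.1 (abs_sum_condMargFst_sub_le hμ0 hεμ hPt.1 hSD h₁ A)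
  have b := abs_le.1 (abs_sum_sub_sum_le_SD (condMargFst P E₀) (condMargFst P E₁) A)
  have hsplit : 4 * ε / μ = 2 * ε / μ + 2 * ε / μ := by ring
  rw [abs_le]
  constructor <;> linarith [b₀.1, b₀.2, b₁.1, b₁.2, b.1, b.2]
end

section
/- For every real b ∈ (0, 1/2) and every natural number ℓ with b·ℓ < 1/4, the quantity (1/2 + b)^ℓ / ((1/2 + b)^ℓ + (1/2 − b)^ℓ) lies in the interval [ (1/2)·(1 + b·ℓ), (1/2)·(1 + 3·b·ℓ) ]. -/
/-- Superadditivity of `artanh`, in polynomial form. -/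
theorem one_sub_mul_one_add_pow_le {u : ℝ} (hu : 0 ≤ u) (k : ℕ) (hk : u * k < 1) :
    (1 - u * k) * (1 + u) ^ k ≤ (1 + u * k) * (1 - u) ^ k := by
  induction k with
  | zero => simp
  | succ k ih =>
    push_cast at hk ⊢
    have hv : 0 ≤ u * k := by positivity
    have hvk : u * k < 1 - u := by linarith
    have hpos : 0 < 1 - u * k := by linarith
    have hQ : 0 ≤ (1 - u) ^ k := pow_nonneg (by linarith) k
    have h1 := mul_le_mul_of_nonneg_left (ih (by linarith))
      (show 0 ≤ (1 - u * (k + 1)) * (1 + u) from mul_nonneg (by linarith) (by linarith))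
    have h2 : (1 - u * (k + 1)) * (1 + u) * (1 + u * k) ≤
        (1 + u * (k + 1)) * (1 - u) * (1 - u * k) := by
      nlinarith [mul_nonneg (mul_nonneg hu hv) (add_nonneg hu hv)]
    have h3 := mul_le_mul_of_nonneg_right h2 hQ
    refine le_of_mul_le_mul_left ?_ hpos
    rw [pow_succ, pow_succ]
    linarith

theorem one_add_half_mul_one_sub_pow_le {u : ℝ} (hu : 0 ≤ u) (hu1 : u ≤ 1) (k : ℕ)
    (hk : u * k ≤ 1) :
    (1 + u * k / 2) * (1 - u) ^ k ≤ (1 - u * k / 2) * (1 + u) ^ k := by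
  have hv : 0 ≤ u * k := by positivity
  have hP : 1 + u * k ≤ (1 + u) ^ k := by
    linarith [one_add_mul_le_pow (show (-2 : ℝ) ≤ u by linarith) k]
  have hPQ : (1 + u) ^ k * (1 - u) ^ k ≤ 1 := by
    rw [← mul_pow]
    exact pow_le_one₀ (mul_nonneg (by linarith) (by linarith)) (by nlinarith)
  have hP2 : (1 + u * k) ^ 2 ≤ ((1 + u) ^ k) ^ 2 := pow_le_pow_left₀ (by linarith) hP 2
  generalize (1 + u) ^ k = P at *
  generalize (1 - u) ^ k = Q at *
  generalize u * k = v at *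
  refine le_of_mul_le_mul_left ?_ (show 0 < P by linarith)
  have h1 := mul_le_mul_of_nonneg_left hPQ (show 0 ≤ 1 + v / 2 by linarith)
  have h2 := mul_le_mul_of_nonneg_left hP2 (show 0 ≤ 1 - v / 2 by linarith)
  have h3 : 1 + v / 2 ≤ (1 - v / 2) * (1 + v) ^ 2 := by
    nlinarith [mul_nonneg hv (show 0 ≤ 1 - v ^ 2 by nlinarith)]
  linarith

/-- For `b ∈ (0, 1/2)` and `ℓ : ℕ` with `b·ℓ < 1/4`,
`(1/2+b)^ℓ / ((1/2+b)^ℓ + (1/2−b)^ℓ) ∈ [½(1+bℓ), ½(1+3bℓ)]`. -/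
theorem ratio_pow_bounds (b : ℝ) (hb : b ∈ Set.Ioo (0:ℝ) (1/2)) (ℓ : ℕ)
    (hbl : b * ℓ < 1/4) :
    (1/2 + b)^ℓ / ((1/2 + b)^ℓ + (1/2 - b)^ℓ) ∈
      Set.Icc ((1/2) * (1 + b * ℓ)) ((1/2) * (1 + 3 * (b * ℓ))) := by
  obtain ⟨hb0, hb1⟩ := hb
  have hx : 0 ≤ b * ℓ := by positivity
  have hu := one_sub_mul_one_add_pow_le (u := 2 * b) (by linarith) ℓ (by linarith)
  have hl := one_add_half_mul_one_sub_pow_le (u := 2 * b) (by linarith) (by linarith) ℓ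
    (by linarith)
  have hP : 0 < (1 + 2 * b) ^ ℓ := pow_pos (by linarith) ℓ
  have hQ : 0 < (1 - 2 * b) ^ ℓ := pow_pos (by linarith) ℓ
  rw [show 1 / 2 + b = (1 / 2) * (1 + 2 * b) by ring,
    show 1 / 2 - b = (1 / 2) * (1 - 2 * b) by ring, mul_pow, mul_pow, ← mul_add,
    mul_div_mul_left _ _ (by positivity)]
  rw [mul_assoc 2 b] at hu hl
  generalize (1 + 2 * b) ^ ℓ = P at *
  generalize (1 - 2 * b) ^ ℓ = Q at *
  generalize b * ℓ = x at *
  constructor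
  · rw [le_div_iff₀ (by linarith)]
    linarith
  · rw [div_le_iff₀ (by linarith)]
    linarith [mul_nonneg hx hP.le, mul_nonneg hx hQ.le]
end

section
/- Let α ∈ (0, 1/2) and let ℓ ≥ 1 be an integer with 1/16 ≤ α·ℓ ≤ 1/4, and let X₁, …, X_ℓ be independent {0,1}-valued random variables, each equal to 1 with probability 1/2 + α. Then the conditional probability that all X_i equal 1, given that either all X_i equal 1 or all X_i equal 0, lies in the interval [17/32, 7/8]. -/
/-- Only the constant vector `b` contributes to a sum restricted to vectors all equal to `b`. -/
lemma sum_ite_forall_eq_prod (n : ℕ) (b : Bool) (f : Bool → ℝ) :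
    (∑ x : Fin n → Bool, if (∀ i, x i = b) then ∏ i, f (x i) else 0) = f b ^ n := by
  rw [Finset.sum_eq_single (fun _ => b)]
  · simp
  · intro x _ hx
    exact if_neg fun h => hx (funext h)
  · simp

lemma sum_ite_constant_prod (n : ℕ) (hn : 1 ≤ n) (f : Bool → ℝ) :
    (∑ x : Fin n → Bool, if ((∀ i, x i = true) ∨ (∀ i, x i = false)) then ∏ i, f (x i) else 0)
      = f true ^ n + f false ^ n := by
  rw [← sum_ite_forall_eq_prod n true f, ← sum_ite_forall_eq_prod n false f,
    ← Finset.sum_add_distrib]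
  refine Finset.sum_congr rfl fun x _ => ?_
  by_cases h₁ : ∀ i, x i = true
  · have h₂ : ¬ ∀ i, x i = false := fun h => by
      simpa [h₁] using h ⟨0, hn⟩
    rw [if_pos (Or.inl h₁), if_pos h₁, if_neg h₂, add_zero]
  · simp only [h₁, false_or, if_false, zero_add]

lemma one_add_mul_half_sub_pow_le_half_add_pow {a : ℝ} (h₀ : 0 ≤ a) (h₁ : a ≤ 1 / 2) (n : ℕ) :
    (1 + 4 * (a * n)) * (1 / 2 - a) ^ n ≤ (1 / 2 + a) ^ n := by
  have hq : 0 ≤ 1 / 2 - a := by linarith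
  calc (1 + 4 * (a * n)) * (1 / 2 - a) ^ n
      = (1 + n * (4 * a)) * (1 / 2 - a) ^ n := by ring
    _ ≤ (1 + 4 * a) ^ n * (1 / 2 - a) ^ n := by
        gcongr
        exact one_add_mul_le_pow (by linarith) n
    _ = ((1 + 4 * a) * (1 / 2 - a)) ^ n := (mul_pow _ _ _).symm
    _ ≤ (1 / 2 + a) ^ n := by
        gcongr
        nlinarith [sq_nonneg a]

lemma half_add_pow_le_four_mul_half_sub_pow {a : ℝ} (h₀ : 0 ≤ a) (h₁ : a ≤ 1 / 2) (n : ℕ)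
    (hn : a * n ≤ 1 / 4) : (1 / 2 + a) ^ n ≤ 4 * (1 / 2 - a) ^ n := by
  have hB : 1 / 2 ≤ (1 - 2 * a) ^ n := by
    have := one_add_mul_le_pow (a := -(2 * a)) (by linarith) n
    rw [← sub_eq_add_neg 1 (2 * a)] at this
    linarith
  have hA : 0 ≤ (1 + 2 * a) ^ n := by positivity
  have hAB : (1 + 2 * a) ^ n * (1 - 2 * a) ^ n ≤ 1 := by
    rw [← mul_pow]
    exact pow_le_one₀ (mul_nonneg (by linarith) (by linarith)) (by nlinarith [sq_nonneg a])
  have hle : (1 + 2 * a) ^ n ≤ 4 * (1 - 2 * a) ^ n := by nlinarith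
  calc (1 / 2 + a) ^ n = (1 / 2) ^ n * (1 + 2 * a) ^ n := by rw [← mul_pow]; ring
    _ ≤ (1 / 2) ^ n * (4 * (1 - 2 * a) ^ n) := by gcongr
    _ = 4 * ((1 / 2) ^ n * (1 - 2 * a) ^ n) := by ring
    _ = 4 * (1 / 2 - a) ^ n := by rw [← mul_pow]; ring

/-- For i.i.d. Bernoulli(1/2+α) bits `X₁,…,X_ℓ` with `α ∈ (0,1/2)` and `1/16 ≤ αℓ ≤ 1/4`,
the probability that all bits are 1, conditioned on all bits being equal, lies in
`[17/32, 7/8]`. -/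
theorem cond_all_ones_bounds (α : ℝ) (hα : α ∈ Set.Ioo (0:ℝ) (1/2)) (ℓ : ℕ) (hℓ : 1 ≤ ℓ)
    (hlo : 1/16 ≤ α * ℓ) (hhi : α * ℓ ≤ 1/4) :
    (∑ x : Fin ℓ → Bool,
        if (∀ i, x i = true) then ∏ i, (if x i then 1/2 + α else 1/2 - α) else 0) /
      (∑ x : Fin ℓ → Bool,
        if ((∀ i, x i = true) ∨ (∀ i, x i = false))
          then ∏ i, (if x i then 1/2 + α else 1/2 - α) else 0)
    ∈ Set.Icc (17/32 : ℝ) (7/8) := by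
  obtain ⟨h₀, h₁⟩ := hα
  have hnum := sum_ite_forall_eq_prod ℓ true (fun b => if b then 1/2 + α else 1/2 - α)
  have hden := sum_ite_constant_prod ℓ hℓ (fun b => if b then 1/2 + α else 1/2 - α)
  simp only [if_true, Bool.false_eq_true, if_false] at hnum hden
  rw [hnum, hden]
  have hq : 0 < (1/2 - α) ^ ℓ := pow_pos (by linarith) ℓ
  have hp : 0 < (1/2 + α) ^ ℓ := pow_pos (by linarith) ℓ
  have hlower := one_add_mul_half_sub_pow_le_half_add_pow h₀.le h₁.le ℓ
  have hupper := half_add_pow_le_four_mul_half_sub_pow h₀.le h₁.le ℓ hhi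
  constructor
  · rw [le_div_iff₀ (by positivity)]
    nlinarith
  · rw [div_le_iff₀ (by positivity)]
    linarith
end

section
/- Every function g : {0,1}ⁿ × {0,1}ⁿ → {0,1} that is not monotone under relabeling has an embedded XOR; that is, there exist x₀, x₁, y₀, y₁ ∈ {0,1}ⁿ such that g(x_b, y_c) = b XOR c for all b, c ∈ {0,1}. -/
/-- `g : {0,1}ⁿ × {0,1}ⁿ → {0,1}` is monotone under relabeling: there are bijections
`σx, σy : [2ⁿ] → {0,1}ⁿ` making `g` monotone in each argument under the relabeled orders. -/
def MonotoneUnderRelabeling {n : ℕ}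
    (g : (Fin n → Bool) × (Fin n → Bool) → Bool) : Prop :=
  ∃ σx σy : Fin (2^n) → (Fin n → Bool),
    Function.Bijective σx ∧ Function.Bijective σy ∧
    (∀ x : Fin n → Bool, ∀ i j : Fin (2^n), i ≤ j → g (x, σy i) ≤ g (x, σy j)) ∧
    (∀ y : Fin n → Bool, ∀ i j : Fin (2^n), i ≤ j → g (σx i, y) ≤ g (σx j, y))

/-- `g` has an embedded XOR: there are `x₀,x₁,y₀,y₁` with `g(x_b, y_c) = b ⊕ c`. -/
def HasEmbeddedXOR {n : ℕ}
    (g : (Fin n → Bool) × (Fin n → Bool) → Bool) : Prop :=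
  ∃ x₀ x₁ y₀ y₁ : Fin n → Bool, ∀ b c : Bool,
    g ((if b then x₁ else x₀), (if c then y₁ else y₀)) = xor b c

/-- A finite family of Boolean functions, no two of which are incomparable, can be enumerated
in pointwise increasing order. -/
theorem exists_bijective_monotone_of_comparable {α β : Type*} [Fintype α] [Fintype β] {N : ℕ}
    (hN : Fintype.card α = N) (f : α → β → Bool)
    (hf : ∀ a a' b b', f a b = true → f a' b = false → f a' b' = true → f a b' = false → False) :
    ∃ σ : Fin N → α, Function.Bijective σ ∧ ∀ b i j, i ≤ j → f (σ i) b ≤ f (σ j) b := by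
  let w : α → ℕ := fun a => (Finset.univ.filter fun b => f a b = true).card
  have hw (a a' : α) (h : w a ≤ w a') (b : β) : f a b ≤ f a' b := by
    by_contra hlt
    have hb : f a b = true ∧ f a' b = false := by
      revert hlt; cases f a b <;> cases f a' b <;> simp
    have hsub : (Finset.univ.filter fun b => f a' b = true) ⊂
        Finset.univ.filter fun b => f a b = true := by
      refine Finset.ssubset_iff_subset_ne.2 ⟨fun b' hb' => ?_, fun heq => ?_⟩
      · by_contra hab
        exact hf a a' b b' hb.1 hb.2 (by simpa using hb') (by simpa using hab)
      · have := Finset.ext_iff.1 heq b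
        simp [hb.1, hb.2] at this
    exact (Finset.card_lt_card hsub).not_ge h
  let e := (Fintype.equivFinOfCardEq hN).symm
  exact ⟨e ∘ Tuple.sort (w ∘ e), e.bijective.comp (Tuple.sort (w ∘ e)).bijective,
    fun b i j hij => hw _ _ (Tuple.monotone_sort (w ∘ e) hij) b⟩

/-- Every function that is not monotone under relabeling has an embedded XOR. -/
theorem embeddedXOR_of_not_monotone {n : ℕ}
    (g : (Fin n → Bool) × (Fin n → Bool) → Bool)
    (h : ¬ MonotoneUnderRelabeling g) : HasEmbeddedXOR g := by
  by_contra hx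
  have key : ∀ x x' y y', g (x, y) = true → g (x', y) = false → g (x', y') = true →
      g (x, y') = false → False := fun x x' y y' h₁ h₂ h₃ h₄ =>
    hx ⟨x, x', y', y, by rintro (_ | _) (_ | _) <;> simp [h₁, h₂, h₃, h₄]⟩
  have hcard : Fintype.card (Fin n → Bool) = 2 ^ n := by simp
  obtain ⟨σx, bx, mx⟩ := exists_bijective_monotone_of_comparable hcard (fun x y => g (x, y)) key
  obtain ⟨σy, bY, my⟩ := exists_bijective_monotone_of_comparable hcard (fun y x => g (x, y))
    fun y y' x x' h₁ h₂ h₃ h₄ => key x x' y y' h₁ h₄ h₃ h₂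
  exact h ⟨σx, σy, bx, bY, my, mx⟩
end
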